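/- Assume q_0 is supported in the Euclidean ball {y ∈ ℝ^d : ‖y‖₂ ≤ √d}. Then there is a universal constant C > 0 such that for every t > 0, E_{X ~ q_t}[ ‖∇_x² log q_t(X) · X‖₂² ] ≤ C d³ σ_t^{−4}, where ∇_x² log q_t(X) · X denotes the Hessian matrix of log q_t at X applied to the vector X. -/

import Mathlib

open MeasureTheory ProbabilityTheory Real

noncomputable section

abbrev Vec (d : ℕ) := EuclideanSpace ℝ (Fin d)

def stdGaussian (d : ℕ) : Measure (Vec d) :=
  Measure.map (⇑(EuclideanSpace.equiv (Fin d) ℝ).symm)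
    (Measure.pi fun _ : Fin d => gaussianReal 0 1)

/-- The law `q_u` of `e^{-u} θ + √(1 - e^{-2u}) g`, with `θ ~ q0` and `g ~ N(0, I_d)`
independent. -/
def forwardLaw {d : ℕ} (q0 : Measure (Vec d)) (u : ℝ) : Measure (Vec d) :=
  Measure.map (fun p : Vec d × Vec d =>
      Real.exp (-u) • p.1 + Real.sqrt (1 - Real.exp (-2*u)) • p.2)
    (q0.prod (stdGaussian d))

/-- Gaussian weight `exp(-‖x - λ_t θ‖² / (2σ_t²))`. -/
def weight {d : ℕ} (t : ℝ) (x θ : Vec d) : ℝ :=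
  Real.exp (-‖x - Real.exp (-t) • θ‖^2 / (2 * (1 - Real.exp (-2*t))))

/-- The conditional law `μ_{t,x}` of `θ` given `λ_t θ + σ_t g = x`:
`dμ_{t,x}(θ) = Z_{t,x}⁻¹ exp(-‖x - λ_t θ‖²/(2σ_t²)) dq0(θ)`. -/
def condMeasure {d : ℕ} (q0 : Measure (Vec d)) (t : ℝ) (x : Vec d) : Measure (Vec d) :=
  (∫⁻ θ, ENNReal.ofReal (weight t x θ) ∂q0)⁻¹ •
    q0.withDensity fun θ => ENNReal.ofReal (weight t x θ)

/-- The conditional mean `m(t, x) = E_{t,x}[θ]`. -/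
def condMean {d : ℕ} (q0 : Measure (Vec d)) (t : ℝ) (x : Vec d) : Vec d :=
  ∫ θ, θ ∂(condMeasure q0 t x)

/-- Partial derivative in the `i`-th coordinate direction. -/
def pd {d : ℕ} (i : Fin d) (f : Vec d → ℝ) (x : Vec d) : ℝ :=
  fderiv ℝ f x (EuclideanSpace.single i 1)

/-- A finite product of one-dimensional Gaussians has the product density. -/
lemma pi_gaussianReal_eq_withDensity {ι : Type*} [Fintype ι] (m : ι → ℝ) {v : NNReal}
    (hv : v ≠ 0) :
    Measure.pi (fun i => gaussianReal (m i) v) =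
      (volume : Measure (ι → ℝ)).withDensity
        fun x => ENNReal.ofReal (∏ i, gaussianPDFReal (m i) v (x i)) := by
  refine Measure.pi_eq fun s hs => ?_
  rw [withDensity_apply _ (MeasurableSet.univ_pi hs), volume_pi, Measure.restrict_pi_pi,
    ← ofReal_integral_eq_lintegral_ofReal,
    integral_fintype_prod_eq_prod (fun i y => gaussianPDFReal (m i) v y),
    ENNReal.ofReal_prod_of_nonneg]
  · exact Finset.prod_congr rfl fun i _ => (gaussianReal_apply_eq_integral _ hv _).symm
  · exact fun i _ => integral_nonneg fun y => gaussianPDFReal_nonneg _ _ _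
  · exact Integrable.fintype_prod fun i => (integrable_gaussianPDFReal (m i) v).restrict
  · exact .of_forall fun x => Finset.prod_nonneg fun i _ => gaussianPDFReal_nonneg _ _ _

lemma one_sub_exp_neg_two_mul_pos {t : ℝ} (ht : 0 < t) : 0 < 1 - Real.exp (-2 * t) := by
  have : Real.exp (-2 * t) < 1 := by simpa using ht
  linarith

/-- The normalizing constant of the Gaussian density with covariance `σ_t² I_d`. -/
def gaussianNormalizer (d : ℕ) (t : ℝ) : ℝ :=
  (√(2 * π * (1 - Real.exp (-2 * t))))⁻¹ ^ d

lemma gaussianNormalizer_pos (d : ℕ) {t : ℝ} (ht : 0 < t) : 0 < gaussianNormalizer d t := by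
  have := one_sub_exp_neg_two_mul_pos ht
  unfold gaussianNormalizer
  positivity

lemma continuous_weight {d : ℕ} (t : ℝ) :
    Continuous fun p : Vec d × Vec d => weight t p.1 p.2 := by
  unfold weight
  fun_prop

lemma continuous_weight_left {d : ℕ} (t : ℝ) (θ : Vec d) : Continuous fun x => weight t x θ := by
  unfold weight
  fun_prop

lemma continuous_weight_right {d : ℕ} (t : ℝ) (x : Vec d) : Continuous (weight t x) := by
  unfold weight
  fun_prop

lemma weight_pos {d : ℕ} (t : ℝ) (x θ : Vec d) : 0 < weight t x θ := Real.exp_pos _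

/-- The conditional law of `λ_t θ + σ_t g` given `θ`. -/
lemma map_stdGaussian_eq_withDensity {d : ℕ} {t : ℝ} (ht : 0 < t) (θ : Vec d) :
    (_root_.stdGaussian d).map
        (fun g => Real.exp (-t) • θ + Real.sqrt (1 - Real.exp (-2 * t)) • g) =
      volume.withDensity fun x => ENNReal.ofReal (gaussianNormalizer d t * weight t x θ) := by
  have hs := one_sub_exp_neg_two_mul_pos ht
  set s : ℝ := 1 - Real.exp (-2 * t) with hs_def
  obtain ⟨v, hvs⟩ : ∃ v : NNReal, (v : ℝ) = s := ⟨s.toNNReal, Real.coe_toNNReal _ hs.le⟩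
  have hv : v ≠ 0 := by
    rintro rfl
    exact hs.ne hvs
  have hcoord (i : Fin d) : (gaussianReal 0 1).map (fun y => Real.exp (-t) * θ i + √s * y) =
      gaussianReal (Real.exp (-t) * θ i) v := by
    have : (fun y => Real.exp (-t) * θ i + √s * y) =
        (fun y => Real.exp (-t) * θ i + y) ∘ (fun y => √s * y) := rfl
    rw [this, ← Measure.map_map (by fun_prop) (by fun_prop), gaussianReal_map_const_mul,
      gaussianReal_map_const_add]
    congr 1
    · simp
    · ext
      simp [Real.sq_sqrt hs.le, hvs]
  have hpi : (Measure.pi fun _ : Fin d => gaussianReal 0 1).map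
      (fun g i => Real.exp (-t) * θ i + √s * g i) =
        Measure.pi fun i => gaussianReal (Real.exp (-t) * θ i) v := by
    simp_rw [← hcoord]
    exact Measure.pi_map_pi (f := fun i y => Real.exp (-t) * θ i + √s * y)
      fun i => by fun_prop
  have hfun : (fun g : Vec d => Real.exp (-t) • θ + √s • g) ∘
      ⇑(EuclideanSpace.equiv (Fin d) ℝ).symm =
      (WithLp.toLp 2) ∘ (fun g i => Real.exp (-t) * θ i + √s * g i) := by
    ext g i
    simp
  rw [_root_.stdGaussian, Measure.map_map (by fun_prop) (by fun_prop), hfun,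
    ← Measure.map_map (by fun_prop) (by fun_prop), hpi, pi_gaussianReal_eq_withDensity _ hv]
  have hprod (x : Fin d → ℝ) :
      ∏ i, gaussianPDFReal (Real.exp (-t) * θ i) v (x i) =
        gaussianNormalizer d t * weight t (WithLp.toLp 2 x) θ := by
    simp only [gaussianPDFReal, Finset.prod_mul_distrib, ← Real.exp_sum, weight,
      gaussianNormalizer, ← hs_def, EuclideanSpace.norm_sq_eq]
    simp [Finset.sum_div, neg_div, hvs]
  ext A hA
  have hw : Measurable fun x : Vec d => weight t x θ :=
    (continuous_weight_left t θ).measurable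
  rw [Measure.map_apply (by fun_prop) hA,
    withDensity_apply _ ((by fun_prop : Measurable (WithLp.toLp 2)) hA), withDensity_apply _ hA,
    ← (PiLp.volume_preserving_toLp (Fin d)).setLIntegral_comp_preimage hA (by fun_prop)]
  simp_rw [hprod]

/-- Integrating against the conditional law of `λ_t θ + σ_t g` given `θ`. -/
lemma lintegral_stdGaussian_comp {d : ℕ} {t : ℝ} (ht : 0 < t) (θ : Vec d)
    {k : Vec d → ENNReal} (hk : Measurable k) :
    ∫⁻ g, k (Real.exp (-t) • θ + Real.sqrt (1 - Real.exp (-2 * t)) • g) ∂(_root_.stdGaussian d) =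
      ∫⁻ x, ENNReal.ofReal (gaussianNormalizer d t * weight t x θ) * k x := by
  have hw : Measurable fun x : Vec d => weight t x θ :=
    (continuous_weight_left t θ).measurable
  rw [← lintegral_map hk (by fun_prop), map_stdGaussian_eq_withDensity ht,
    lintegral_withDensity_eq_lintegral_mul _ (by fun_prop) hk]
  rfl

instance isProbabilityMeasure_stdGaussian (d : ℕ) :
    IsProbabilityMeasure (_root_.stdGaussian d) := by
  unfold _root_.stdGaussian
  exact Measure.isProbabilityMeasure_map (by fun_prop)

lemma weight_le_one {d : ℕ} {t : ℝ} (ht : 0 < t) (x θ : Vec d) : weight t x θ ≤ 1 := by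
  have := one_sub_exp_neg_two_mul_pos ht
  refine Real.exp_le_one_iff.2 (div_nonpos_of_nonpos_of_nonneg ?_ (by linarith))
  simp

lemma integrable_weight {d : ℕ} (q0 : Measure (Vec d)) [IsProbabilityMeasure q0] {t : ℝ}
    (ht : 0 < t) (x : Vec d) : Integrable (weight t x) q0 := by
  refine Integrable.of_bound (C := 1) ?_ (.of_forall fun θ => ?_)
  · exact (continuous_weight_right t x).aestronglyMeasurable
  · rw [Real.norm_of_nonneg (weight_pos t x θ).le]
    exact weight_le_one ht x θ

lemma forwardLaw_eq_withDensity {d : ℕ} (q0 : Measure (Vec d)) [IsProbabilityMeasure q0] {t : ℝ}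
    (ht : 0 < t) :
    forwardLaw q0 t = volume.withDensity fun x =>
      ENNReal.ofReal (gaussianNormalizer d t * ∫ θ, weight t x θ ∂q0) := by
  have hc := gaussianNormalizer_pos d ht
  have hw := (continuous_weight (d := d) t).measurable
  ext A hA
  have hAi : Measurable (A.indicator (1 : Vec d → ENNReal)) := measurable_one.indicator hA
  rw [forwardLaw, ← lintegral_indicator_one hA, lintegral_map hAi (by fun_prop),
    lintegral_prod _ (by fun_prop)]
  simp_rw [lintegral_stdGaussian_comp ht _ hAi]
  rw [lintegral_lintegral_swap (by fun_prop), withDensity_apply _ hA, ← lintegral_indicator hA]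
  refine lintegral_congr fun x => ?_
  rw [lintegral_mul_const _ (by fun_prop),
    ← ofReal_integral_eq_lintegral_ofReal ((integrable_weight q0 ht x).const_mul _)
      (.of_forall fun θ => mul_nonneg hc.le (weight_pos t x θ).le), integral_const_mul]
  by_cases hx : x ∈ A <;> simp [hx]

/-- The density is the Gaussian mixture at every point. -/
lemma density_eq_mixture {d : ℕ} (q0 : Measure (Vec d)) [IsProbabilityMeasure q0] {t : ℝ}
    (ht : 0 < t) {r : Vec d → ℝ} (hr : Continuous r) (hr0 : ∀ x, 0 < r x)
    (hlaw : forwardLaw q0 t = volume.withDensity fun x => ENNReal.ofReal (r x)) (x : Vec d) :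
    r x = gaussianNormalizer d t * ∫ θ, weight t x θ ∂q0 := by
  have hc := gaussianNormalizer_pos d ht
  have hcont : Continuous fun x => gaussianNormalizer d t * ∫ θ, weight t x θ ∂q0 := by
    refine continuous_const.mul (continuous_of_dominated (bound := fun _ => 1)
      (fun x => (integrable_weight q0 ht x).aestronglyMeasurable) (fun x => .of_forall fun θ => ?_)
      (integrable_const 1) (.of_forall fun θ => ?_))
    · rw [Real.norm_of_nonneg (weight_pos t x θ).le]
      exact weight_le_one ht x θ
    · exact continuous_weight_left t θ
  have hae := (withDensity_eq_iff_of_sigmaFinite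
    hr.measurable.ennreal_ofReal.aemeasurable hcont.measurable.ennreal_ofReal.aemeasurable).1
    (hlaw.symm.trans (forwardLaw_eq_withDensity q0 ht))
  refine congrFun (Continuous.ae_eq_iff_eq volume hr hcont |>.1 ?_) x
  filter_upwards [hae] with y hy
  refine (ENNReal.ofReal_eq_ofReal_iff (hr0 y).le ?_).1 hy
  exact mul_nonneg hc.le (integral_nonneg fun θ => (weight_pos t y θ).le)

lemma integrable_of_continuous_of_ae_norm_le {d : ℕ} {q0 : Measure (Vec d)}
    [IsProbabilityMeasure q0] {R : ℝ} (hR : ∀ᵐ y ∂q0, ‖y‖ ≤ R) {f : Vec d → ℝ}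
    (hf : Continuous f) : Integrable f q0 := by
  obtain ⟨C, hC⟩ := (isCompact_closedBall (0 : Vec d) R).exists_bound_of_continuousOn
    hf.continuousOn
  refine Integrable.of_bound (C := C) hf.aestronglyMeasurable ?_
  filter_upwards [hR] with y hy
  exact hC y (by simpa using hy)

/-- Differentiation under the integral sign along a line, for a boundedly supported measure. -/
lemma hasLineDerivAt_integral {d : ℕ} {q0 : Measure (Vec d)} [IsProbabilityMeasure q0]
    {R : ℝ} (hR : ∀ᵐ y ∂q0, ‖y‖ ≤ R) {ψ ψ' : Vec d → Vec d → ℝ}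
    (hψ : Continuous fun p : Vec d × Vec d => ψ p.1 p.2)
    (hψ' : Continuous fun p : Vec d × Vec d => ψ' p.1 p.2) (v : Vec d)
    (h : ∀ x θ, HasLineDerivAt ℝ (fun y => ψ y θ) (ψ' x θ) x v) (x : Vec d) :
    HasLineDerivAt ℝ (fun y => ∫ θ, ψ y θ ∂q0) (∫ θ, ψ' x θ ∂q0) x v := by
  have hF' : Continuous fun p : ℝ × Vec d => ψ' (x + p.1 • v) p.2 :=
    hψ'.comp (by fun_prop : Continuous fun p : ℝ × Vec d => (x + p.1 • v, p.2))
  have hFr (r : ℝ) : Continuous fun θ => ψ (x + r • v) θ :=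
    hψ.comp (by fun_prop : Continuous fun θ : Vec d => (x + r • v, θ))
  have hFr' (r : ℝ) : Continuous fun θ => ψ' (x + r • v) θ :=
    hψ'.comp (by fun_prop : Continuous fun θ : Vec d => (x + r • v, θ))
  obtain ⟨C, hC⟩ := ((isCompact_closedBall (0 : ℝ) 1).prod
    (isCompact_closedBall (0 : Vec d) R)).exists_bound_of_continuousOn hF'.continuousOn
  have key := (hasDerivAt_integral_of_dominated_loc_of_deriv_le (μ := q0) (x₀ := (0 : ℝ))
    (F := fun r θ => ψ (x + r • v) θ) (F' := fun r θ => ψ' (x + r • v) θ)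
    (bound := fun _ => C) (Metric.ball_mem_nhds 0 one_pos)
    (.of_forall fun r => (hFr r).aestronglyMeasurable)
    (integrable_of_continuous_of_ae_norm_le hR (hFr 0))
    (hFr' 0).aestronglyMeasurable
    (by
      filter_upwards [hR] with θ hθ r hr
      exact hC (r, θ) ⟨Metric.ball_subset_closedBall hr, by simpa using hθ⟩)
    (integrable_const C)
    (.of_forall fun θ r _ => by
      have h1 : HasDerivAt (fun u : ℝ => ψ (x + r • v + u • v) θ) (ψ' (x + r • v) θ) (r - r) := by
        rw [sub_self]
        exact h (x + r • v) θ
      have h2 := h1.comp_sub_const r r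
      refine h2.congr_of_eventuallyEq (.of_forall fun u => ?_)
      have : x + u • v = x + r • v + (u - r) • v := by module
      simp [this])).2
  simpa [HasLineDerivAt] using key

lemma hasLineDerivAt_weight {d : ℕ} {t : ℝ} (ht : 0 < t) (i : Fin d) (x θ : Vec d) :
    HasLineDerivAt ℝ (fun y => weight t y θ)
      (-((x - Real.exp (-t) • θ) i * weight t x θ) / (1 - Real.exp (-2 * t))) x
      (EuclideanSpace.single i 1) := by
  have hs := (one_sub_exp_neg_two_mul_pos ht).ne'
  have h1 : HasDerivAt (fun r : ℝ => x + r • EuclideanSpace.single i (1 : ℝ) - Real.exp (-t) • θ)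
      (EuclideanSpace.single i (1 : ℝ)) 0 := by
    simpa using ((((hasDerivAt_id (0 : ℝ)).smul_const
      (EuclideanSpace.single i (1 : ℝ))).const_add x).sub_const (Real.exp (-t) • θ))
  have h2 := (h1.norm_sq.neg.div_const (2 * (1 - Real.exp (-2 * t)))).exp
  refine h2.congr_deriv ?_
  simp [EuclideanSpace.inner_single_right, weight]
  field_simp

lemma hasLineDerivAt_residual_mul_weight {d : ℕ} {t : ℝ} (ht : 0 < t) (i j : Fin d)
    (x θ : Vec d) :
    HasLineDerivAt ℝ (fun y => (y - Real.exp (-t) • θ) j * weight t y θ)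
      ((if i = j then 1 else 0) * weight t x θ -
        (x - Real.exp (-t) • θ) i * (x - Real.exp (-t) • θ) j * weight t x θ /
          (1 - Real.exp (-2 * t))) x
      (EuclideanSpace.single i 1) := by
  have h1 : HasDerivAt
      (fun r : ℝ => (x + r • EuclideanSpace.single i (1 : ℝ) - Real.exp (-t) • θ) j)
      (if i = j then 1 else 0) 0 := by
    have := (((hasDerivAt_id (0 : ℝ)).mul_const (if i = j then (1 : ℝ) else 0)).const_add
      (x j)).sub_const (Real.exp (-t) * θ j)
    simpa [Pi.single_apply, eq_comm] using this
  have h2 : HasDerivAt _ _ (0 : ℝ) := hasLineDerivAt_weight ht i x θ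
  have h3 := h1.mul h2
  refine h3.congr_deriv ?_
  simp
  ring

lemma pd_eq_of_hasLineDerivAt {d : ℕ} {i : Fin d} {f : Vec d → ℝ} {x : Vec d} {f' : ℝ}
    (hf : DifferentiableAt ℝ f x) (h : HasLineDerivAt ℝ f f' x (EuclideanSpace.single i 1)) :
    pd i f x = f' := by
  rw [pd, ← hf.lineDeriv_eq_fderiv, h.lineDeriv]

lemma differentiable_pd {d : ℕ} (i : Fin d) {f : Vec d → ℝ} (hf : ContDiff ℝ (⊤ : ℕ∞) f) :
    Differentiable ℝ (pd i f) := by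
  have : ContDiff ℝ 1 (fderiv ℝ f) := hf.fderiv_right (by norm_cast)
  exact fun x => ((this.differentiable one_ne_zero) x).clm_apply (differentiableAt_const _)

section Mixture

variable {d : ℕ} {q0 : Measure (Vec d)} [IsProbabilityMeasure q0] {R : ℝ}

lemma continuous_residual_mul_weight (t : ℝ) (j : Fin d) :
    Continuous fun p : Vec d × Vec d => (p.1 - Real.exp (-t) • p.2) j * weight t p.1 p.2 := by
  have := continuous_weight (d := d) t
  fun_prop

lemma integral_weight_pos (hR : ∀ᵐ y ∂q0, ‖y‖ ≤ R) (t : ℝ) (x : Vec d) :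
    0 < ∫ θ, weight t x θ ∂q0 := by
  have hc := continuous_weight_right t x
  refine (integral_pos_iff_support_of_nonneg (fun θ => (weight_pos t x θ).le)
    (integrable_of_continuous_of_ae_norm_le hR hc)).2 ?_
  have : Function.support (fun θ => weight t x θ) = Set.univ :=
    Set.eq_univ_of_forall fun θ => (weight_pos t x θ).ne'
  simp [this]

lemma hasLineDerivAt_integral_weight (hR : ∀ᵐ y ∂q0, ‖y‖ ≤ R) {t : ℝ} (ht : 0 < t) (i : Fin d)
    (x : Vec d) :
    HasLineDerivAt ℝ (fun y => ∫ θ, weight t y θ ∂q0)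
      (-(∫ θ, (x - Real.exp (-t) • θ) i * weight t x θ ∂q0) / (1 - Real.exp (-2 * t))) x
      (EuclideanSpace.single i 1) := by
  have := hasLineDerivAt_integral hR (continuous_weight t)
    ((continuous_residual_mul_weight t i).neg.div_const _) _
    (hasLineDerivAt_weight ht i) x
  rwa [integral_div, integral_neg] at this

lemma hasLineDerivAt_integral_residual_mul_weight (hR : ∀ᵐ y ∂q0, ‖y‖ ≤ R) {t : ℝ} (ht : 0 < t)
    (i j : Fin d) (x : Vec d) :
    HasLineDerivAt ℝ (fun y => ∫ θ, (y - Real.exp (-t) • θ) j * weight t y θ ∂q0)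
      ((if i = j then 1 else 0) * (∫ θ, weight t x θ ∂q0) -
        (∫ θ, (x - Real.exp (-t) • θ) i * (x - Real.exp (-t) • θ) j * weight t x θ ∂q0) /
          (1 - Real.exp (-2 * t))) x
      (EuclideanSpace.single i 1) := by
  have hw := continuous_weight (d := d) t
  have hwx := continuous_weight_right t x
  have := hasLineDerivAt_integral hR (continuous_residual_mul_weight t j)
    (ψ' := fun x θ => (if i = j then 1 else 0) * weight t x θ -
        (x - Real.exp (-t) • θ) i * (x - Real.exp (-t) • θ) j * weight t x θ /
          (1 - Real.exp (-2 * t))) (by fun_prop) _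
    (hasLineDerivAt_residual_mul_weight ht i j) x
  rwa [integral_sub (integrable_of_continuous_of_ae_norm_le hR (by fun_prop))
    (integrable_of_continuous_of_ae_norm_le hR (by fun_prop)), integral_const_mul,
    integral_div] at this

/-- The Hessian of the log-density of a Gaussian mixture, in terms of the weighted first and
second moments of the residual `x - λ_t θ`. -/
lemma pd_pd_log_mixture (hR : ∀ᵐ y ∂q0, ‖y‖ ≤ R) {t : ℝ} (ht : 0 < t) {r : Vec d → ℝ}
    (hr : ContDiff ℝ (⊤ : ℕ∞) r) (hr0 : ∀ x, 0 < r x) {c : ℝ} (hc : 0 < c)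
    (hmix : ∀ x, r x = c * ∫ θ, weight t x θ ∂q0) (i j : Fin d) (x : Vec d) :
    pd i (pd j fun y => Real.log (r y)) x =
      -(if i = j then 1 else 0) / (1 - Real.exp (-2 * t)) +
      ((∫ θ, (x - Real.exp (-t) • θ) i * (x - Real.exp (-t) • θ) j * weight t x θ ∂q0) /
          (∫ θ, weight t x θ ∂q0) -
        (∫ θ, (x - Real.exp (-t) • θ) i * weight t x θ ∂q0) *
          (∫ θ, (x - Real.exp (-t) • θ) j * weight t x θ ∂q0) /
          (∫ θ, weight t x θ ∂q0) ^ 2) / (1 - Real.exp (-2 * t)) ^ 2 := by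
  have hs := (one_sub_exp_neg_two_mul_pos ht).ne'
  have hL : ContDiff ℝ (⊤ : ℕ∞) fun y => Real.log (r y) := hr.log fun y => (hr0 y).ne'
  have hZ (y : Vec d) : (∫ θ, weight t y θ ∂q0) ≠ 0 := (integral_weight_pos hR t y).ne'
  have hfirst : (pd j fun y => Real.log (r y)) = fun y =>
      -((∫ θ, (y - Real.exp (-t) • θ) j * weight t y θ ∂q0) / (∫ θ, weight t y θ ∂q0)) /
        (1 - Real.exp (-2 * t)) := by
    ext y
    refine pd_eq_of_hasLineDerivAt (hL.differentiable (by simp) y) ?_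
    have h1 : HasDerivAt _ _ (0 : ℝ) := hasLineDerivAt_integral_weight hR ht j y
    have h2 := (h1.const_mul c).log (by simpa using ⟨hc.ne', hZ y⟩)
    simp_rw [hmix]
    refine h2.congr_deriv ?_
    have := hZ y
    simp
    field_simp
  refine pd_eq_of_hasLineDerivAt (differentiable_pd j hL x) ?_
  rw [hfirst]
  have h1 : HasDerivAt _ _ (0 : ℝ) := hasLineDerivAt_integral_weight hR ht i x
  have h2 : HasDerivAt _ _ (0 : ℝ) := hasLineDerivAt_integral_residual_mul_weight hR ht i j x
  have h3 := (h2.div h1 (by simpa using hZ x)).neg.div_const (1 - Real.exp (-2 * t))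
  refine h3.congr_deriv ?_
  have := hZ x
  simp only [zero_smul, add_zero]
  generalize 1 - Real.exp (-2 * t) = s at hs ⊢
  field_simp
  ring

end Mixture

lemma sq_integral_mul_le {α : Type*} [MeasurableSpace α] {μ : Measure α} {w h : α → ℝ}
    (hw0 : ∀ a, 0 ≤ w a) (hw : Integrable w μ) (hh : Integrable (fun a => h a * w a) μ)
    (hh2 : Integrable (fun a => h a ^ 2 * w a) μ) (hZ : 0 < ∫ a, w a ∂μ) :
    (∫ a, h a * w a ∂μ) ^ 2 ≤ (∫ a, w a ∂μ) * ∫ a, h a ^ 2 * w a ∂μ := by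
  set Z := ∫ a, w a ∂μ
  set m := ∫ a, h a * w a ∂μ with hm
  have key : 0 ≤ ∫ a, (Z * (h a ^ 2 * w a) - (2 * m) * (h a * w a) + m ^ 2 / Z * w a) ∂μ := by
    refine integral_nonneg fun a => ?_
    have : Z * (h a ^ 2 * w a) - (2 * m) * (h a * w a) + m ^ 2 / Z * w a =
        (Z * h a - m) ^ 2 / Z * w a := by
      field_simp
      ring
    simp only [Pi.zero_apply, this]
    have := hw0 a
    positivity
  rw [integral_add (by exact (hh2.const_mul _).sub (hh.const_mul _)) (hw.const_mul _),
    integral_sub (hh2.const_mul _) (hh.const_mul _), integral_const_mul, integral_const_mul,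
    integral_const_mul, ← hm] at key
  have : m ^ 2 / Z * Z = m ^ 2 := by field_simp
  change 0 ≤ _ - _ + m ^ 2 / Z * Z at key
  nlinarith

/-- Second-moment bound for a matrix of the form `-I / s + Cov / s²` applied to `x`, with the
covariance taken under the unnormalized weight `w`. -/
lemma integral_mul_sum_sq_le {d : ℕ} {α : Type*} [MeasurableSpace α] {μ : Measure α} {w : α → ℝ}
    {a : α → Vec d} (hw0 : ∀ θ, 0 ≤ w θ) (hZ : 0 < ∫ θ, w θ ∂μ)
    (hint : ∀ f : Vec d → ℝ, Continuous f → Integrable (fun θ => f (a θ) * w θ) μ)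
    {s : ℝ} (hs : 0 < s) (x : Vec d) :
    (∫ θ, w θ ∂μ) * ∑ i, (∑ j, (-(if i = j then 1 else 0) / s +
        ((∫ θ, a θ i * a θ j * w θ ∂μ) / (∫ θ, w θ ∂μ) -
          (∫ θ, a θ i * w θ ∂μ) * (∫ θ, a θ j * w θ ∂μ) / (∫ θ, w θ ∂μ) ^ 2) / s ^ 2) * x j) ^ 2 ≤
      ∫ θ, 3 * ‖x‖ ^ 2 * (1 / s ^ 2 + 2 * ‖a θ‖ ^ 4 / s ^ 4) * w θ ∂μ := by
  have hw : Integrable w μ := by simpa using hint (fun _ => 1) continuous_const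
  set Z := ∫ θ, w θ ∂μ
  set b : Vec d → ℝ := fun y => ∑ j, y j * x j with hb
  have hbc : Continuous b := by fun_prop
  have hbx (y : Vec d) : b y ^ 2 ≤ ‖y‖ ^ 2 * ‖x‖ ^ 2 := by
    rw [EuclideanSpace.real_norm_sq_eq, EuclideanSpace.real_norm_sq_eq]
    exact Finset.sum_mul_sq_le_sq_mul_sq _ _ _
  set P : Fin d → ℝ := fun i => ∫ θ, a θ i * b (a θ) * w θ ∂μ with hP
  set m : Fin d → ℝ := fun i => ∫ θ, a θ i * w θ ∂μ with hm
  set B : ℝ := ∫ θ, b (a θ) * w θ ∂μ with hB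
  set Q : ℝ := ∫ θ, ‖a θ‖ ^ 4 * w θ ∂μ with hQ
  set S : ℝ := ∫ θ, ‖a θ‖ ^ 2 * w θ ∂μ with hS
  have cs (f : Vec d → ℝ) (hf : Continuous f) :
      (∫ θ, f (a θ) * w θ ∂μ) ^ 2 ≤ Z * ∫ θ, f (a θ) ^ 2 * w θ ∂μ :=
    sq_integral_mul_le hw0 hw (hint f hf) (hint (fun y => f y ^ 2) (by fun_prop)) hZ
  have hS0 : 0 ≤ S := integral_nonneg fun θ => mul_nonneg (by positivity) (hw0 θ)
  have hPsum : ∑ i, P i ^ 2 ≤ Z * (‖x‖ ^ 2 * Q) := by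
    calc ∑ i, P i ^ 2 ≤ ∑ i, Z * ∫ θ, (a θ i * b (a θ)) ^ 2 * w θ ∂μ :=
          Finset.sum_le_sum fun i _ => cs (fun y => y i * b y) (by fun_prop)
      _ = Z * ∫ θ, ∑ i, (a θ i * b (a θ)) ^ 2 * w θ ∂μ := by
          rw [← Finset.mul_sum, integral_finsetSum]
          exact fun i _ => hint (fun y => (y i * b y) ^ 2) (by fun_prop)
      _ ≤ Z * (‖x‖ ^ 2 * Q) := by
          rw [hQ, ← integral_const_mul (‖x‖ ^ 2)]
          refine mul_le_mul_of_nonneg_left (integral_mono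
            (integrable_finsetSum _ fun i _ => hint (fun y => (y i * b y) ^ 2) (by fun_prop))
            ((hint (fun y => ‖y‖ ^ 4) (by fun_prop)).const_mul _) fun θ => ?_) hZ.le
          have h1 : ∑ i, (a θ i * b (a θ)) ^ 2 * w θ = ‖a θ‖ ^ 2 * b (a θ) ^ 2 * w θ := by
            rw [EuclideanSpace.real_norm_sq_eq, Finset.sum_mul, Finset.sum_mul]
            exact Finset.sum_congr rfl fun i _ => by ring
          have h2 : ‖a θ‖ ^ 2 * b (a θ) ^ 2 ≤ ‖x‖ ^ 2 * ‖a θ‖ ^ 4 := by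
            nlinarith [mul_le_mul_of_nonneg_left (hbx (a θ)) (sq_nonneg ‖a θ‖)]
          simp only [h1, ← mul_assoc]
          exact mul_le_mul_of_nonneg_right h2 (hw0 θ)
  have hmsum : ∑ i, m i ^ 2 ≤ Z * S := by
    calc ∑ i, m i ^ 2 ≤ ∑ i, Z * ∫ θ, (a θ i) ^ 2 * w θ ∂μ :=
          Finset.sum_le_sum fun i _ => cs (fun y => y i) (by fun_prop)
      _ = Z * ∫ θ, ∑ i, (a θ i) ^ 2 * w θ ∂μ := by
          rw [← Finset.mul_sum, integral_finsetSum]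
          exact fun i _ => hint (fun y => (y i) ^ 2) (by fun_prop)
      _ = Z * S := by simp_rw [hS, EuclideanSpace.real_norm_sq_eq, Finset.sum_mul]
  have hBsq : B ^ 2 ≤ Z * (‖x‖ ^ 2 * S) := by
    refine (cs b hbc).trans (mul_le_mul_of_nonneg_left ?_ hZ.le)
    rw [hS, ← integral_const_mul]
    refine integral_mono (hint (fun y => b y ^ 2) (by fun_prop))
      ((hint (fun y => ‖y‖ ^ 2) (by fun_prop)).const_mul _) fun θ => ?_
    simp only [← mul_assoc]
    exact mul_le_mul_of_nonneg_right ((hbx _).trans_eq (mul_comm _ _)) (hw0 θ)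
  have hSQ : S ^ 2 ≤ Z * Q := by
    have := cs (fun y => ‖y‖ ^ 2) (by fun_prop)
    simpa only [← pow_mul] using this
  have hrow (i : Fin d) : ∑ j, (-(if i = j then 1 else 0) / s +
        ((∫ θ, a θ i * a θ j * w θ ∂μ) / Z - m i * m j / Z ^ 2) / s ^ 2) * x j =
      -x i / s + P i / (Z * s ^ 2) - m i * B / (Z ^ 2 * s ^ 2) := by
    have hPi : P i = ∑ j, (∫ θ, a θ i * a θ j * w θ ∂μ) * x j := by
      simp_rw [hP, hb, ← integral_mul_const]
      rw [← integral_finsetSum]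
      · refine integral_congr_ae (.of_forall fun θ => ?_)
        simp only [Finset.mul_sum, Finset.sum_mul]
        exact Finset.sum_congr rfl fun j _ => by ring
      · exact fun j _ => (hint (fun y => y i * y j) (by fun_prop)).mul_const _
    have hBj : B = ∑ j, m j * x j := by
      simp_rw [hB, hb, hm, ← integral_mul_const]
      rw [← integral_finsetSum]
      · refine integral_congr_ae (.of_forall fun θ => ?_)
        simp only [Finset.sum_mul]
        exact Finset.sum_congr rfl fun j _ => by ring
      · exact fun j _ => (hint (fun y => y j) (by fun_prop)).mul_const _
    have hdelta : -x i / s = ∑ j, -(if i = j then 1 else 0) / s * x j := by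
      simp [div_eq_inv_mul]
    rw [hPi, hBj, hdelta, Finset.mul_sum, Finset.sum_div, Finset.sum_div,
      ← Finset.sum_add_distrib, ← Finset.sum_sub_distrib]
    refine Finset.sum_congr rfl fun j _ => ?_
    field_simp
    ring
  have hrhs : ∫ θ, 3 * ‖x‖ ^ 2 * (1 / s ^ 2 + 2 * ‖a θ‖ ^ 4 / s ^ 4) * w θ ∂μ =
      3 * ‖x‖ ^ 2 / s ^ 2 * Z + 6 * ‖x‖ ^ 2 / s ^ 4 * Q := by
    rw [← integral_const_mul, hQ, ← integral_const_mul, ← integral_add (hw.const_mul _)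
      ((hint (fun y => ‖y‖ ^ 4) (by fun_prop)).const_mul _)]
    refine integral_congr_ae (.of_forall fun θ => ?_)
    simp only
    field_simp
    ring
  have hsum : ∑ i, (-x i / s + P i / (Z * s ^ 2) - m i * B / (Z ^ 2 * s ^ 2)) ^ 2 ≤
      3 * (‖x‖ ^ 2 / s ^ 2 + (∑ i, P i ^ 2) / (Z ^ 2 * s ^ 4) +
        (∑ i, m i ^ 2) * B ^ 2 / (Z ^ 4 * s ^ 4)) := by
    rw [EuclideanSpace.real_norm_sq_eq, Finset.sum_mul, Finset.sum_div, Finset.sum_div,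
      Finset.sum_div, ← Finset.sum_add_distrib, ← Finset.sum_add_distrib, Finset.mul_sum]
    refine Finset.sum_le_sum fun i _ => ?_
    have h1 : x i ^ 2 / s ^ 2 = (-x i / s) ^ 2 := by ring
    have h2 : P i ^ 2 / (Z ^ 2 * s ^ 4) = (P i / (Z * s ^ 2)) ^ 2 := by ring
    have h3 : m i ^ 2 * B ^ 2 / (Z ^ 4 * s ^ 4) = (m i * B / (Z ^ 2 * s ^ 2)) ^ 2 := by ring
    rw [h1, h2, h3]
    generalize -x i / s = u
    generalize P i / (Z * s ^ 2) = v
    generalize m i * B / (Z ^ 2 * s ^ 2) = y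
    nlinarith [sq_nonneg (u - v), sq_nonneg (u + y), sq_nonneg (v + y)]
  have hmB : (∑ i, m i ^ 2) * B ^ 2 ≤ Z ^ 3 * (‖x‖ ^ 2 * Q) := by
    calc (∑ i, m i ^ 2) * B ^ 2 ≤ (Z * S) * (Z * (‖x‖ ^ 2 * S)) := by gcongr
      _ = Z ^ 2 * ‖x‖ ^ 2 * S ^ 2 := by ring
      _ ≤ Z ^ 2 * ‖x‖ ^ 2 * (Z * Q) := by gcongr
      _ = _ := by ring
  rw [hrhs]
  calc _ ≤ Z * (3 * (‖x‖ ^ 2 / s ^ 2 + (Z * (‖x‖ ^ 2 * Q)) / (Z ^ 2 * s ^ 4) +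
        Z ^ 3 * (‖x‖ ^ 2 * Q) / (Z ^ 4 * s ^ 4))) := by
        refine mul_le_mul_of_nonneg_left (le_of_eq_of_le (Finset.sum_congr rfl fun i _ =>
          congrArg (· ^ 2) (hrow i)) (hsum.trans ?_)) hZ.le
        gcongr
    _ = _ := by
        field_simp
        ring

lemma integrable_pow_six_gaussianReal :
    Integrable (fun y : ℝ => y ^ 6) (gaussianReal 0 1) := by
  have := (memLp_id_gaussianReal (μ := 0) (v := 1) 6).integrable_norm_pow (by norm_num)
  refine this.congr (.of_forall fun y => ?_)
  simp [(by decide : Even 6).pow_abs]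

/-- The sixth moment of the norm of a standard Gaussian vector is `O(d³)`. -/
lemma lintegral_stdGaussian_le {d : ℕ} {A : ℝ} (hA : 0 ≤ A) :
    ∫⁻ g, ENNReal.ofReal (A * ((d : ℝ) ^ 3 + ‖g‖ ^ 6)) ∂(_root_.stdGaussian d) ≤
      ENNReal.ofReal (A * ((1 + ∫ y, y ^ 6 ∂(gaussianReal 0 1)) * (d : ℝ) ^ 3)) := by
  have hint (i : Fin d) : Integrable (fun g : Fin d → ℝ => g i ^ 6)
      (Measure.pi fun _ : Fin d => gaussianReal 0 1) :=
    integrable_comp_eval (μ := fun _ : Fin d => gaussianReal 0 1) (f := fun y : ℝ => y ^ 6)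
      integrable_pow_six_gaussianReal
  have hsum : Integrable (fun g : Fin d → ℝ => A * ((d : ℝ) ^ 3 + (d : ℝ) ^ 2 * ∑ i, g i ^ 6))
      (Measure.pi fun _ : Fin d => gaussianReal 0 1) :=
    ((integrable_const _).add ((integrable_finsetSum _ fun i _ => hint i).const_mul _)).const_mul _
  rw [_root_.stdGaussian, lintegral_map (by fun_prop) (by fun_prop)]
  calc _ ≤ ∫⁻ g : Fin d → ℝ, ENNReal.ofReal (A * ((d : ℝ) ^ 3 + (d : ℝ) ^ 2 * ∑ i, g i ^ 6))
          ∂(Measure.pi fun _ : Fin d => gaussianReal 0 1) := by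
        refine lintegral_mono fun g => ENNReal.ofReal_le_ofReal ?_
        gcongr
        have h6 := pow_sum_le_card_mul_sum_pow (s := Finset.univ) (f := fun i => g i ^ 2)
          (fun i _ => sq_nonneg _) 2
        have hn : ‖(EuclideanSpace.equiv (Fin d) ℝ).symm g‖ ^ 6 = (∑ i, g i ^ 2) ^ 3 := by
          rw [show 6 = 2 * 3 from rfl, pow_mul, EuclideanSpace.real_norm_sq_eq]
          rfl
        rw [hn]
        simpa [← pow_mul] using h6
    _ = ENNReal.ofReal (∫ g : Fin d → ℝ, A * ((d : ℝ) ^ 3 + (d : ℝ) ^ 2 * ∑ i, g i ^ 6)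
          ∂(Measure.pi fun _ : Fin d => gaussianReal 0 1)) := by
        refine (ofReal_integral_eq_lintegral_ofReal hsum (.of_forall fun g => ?_)).symm
        have : 0 ≤ ∑ i, g i ^ 6 := Finset.sum_nonneg fun i _ => (by decide : Even 6).pow_nonneg _
        simp only [Pi.zero_apply]
        positivity
    _ = _ := by
        have hi (i : Fin d) : ∫ g : Fin d → ℝ, g i ^ 6
            ∂(Measure.pi fun _ : Fin d => gaussianReal 0 1) = ∫ y, y ^ 6 ∂(gaussianReal 0 1) :=
          integral_comp_eval (μ := fun _ : Fin d => gaussianReal 0 1) (f := fun y : ℝ => y ^ 6)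
            integrable_pow_six_gaussianReal.aestronglyMeasurable
        rw [integral_const_mul, integral_add (integrable_const _)
          ((integrable_finsetSum _ fun i _ => hint i).const_mul _), integral_const_mul,
          integral_finsetSum _ fun i _ => hint i]
        simp only [hi]
        congr 1
        simp only [integral_const, probReal_univ, smul_eq_mul, Finset.sum_const, Finset.card_univ,
          Fintype.card_fin, nsmul_eq_mul]
        ring

lemma three_mul_norm_sq_mul_le {d : ℕ} (hd : 1 ≤ d) {t : ℝ} (ht : 0 < t) {θ : Vec d}
    (hθ : ‖θ‖ ≤ Real.sqrt d) (g : Vec d) :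
    3 * ‖Real.exp (-t) • θ + Real.sqrt (1 - Real.exp (-2 * t)) • g‖ ^ 2 *
        (1 / (1 - Real.exp (-2 * t)) ^ 2 +
          2 * ‖Real.sqrt (1 - Real.exp (-2 * t)) • g‖ ^ 4 / (1 - Real.exp (-2 * t)) ^ 4) ≤
      30 / (1 - Real.exp (-2 * t)) ^ 2 * ((d : ℝ) ^ 3 + ‖g‖ ^ 6) := by
  have hs := one_sub_exp_neg_two_mul_pos ht
  have hs1 : 1 - Real.exp (-2 * t) ≤ 1 := by linarith [Real.exp_pos (-2 * t)]
  have he : Real.exp (-t) ≤ 1 := Real.exp_le_one_iff.2 (by linarith)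
  generalize 1 - Real.exp (-2 * t) = s at hs hs1 ⊢
  have hd1 : (1 : ℝ) ≤ d := by exact_mod_cast hd
  have hθ2 : ‖θ‖ ^ 2 ≤ d := by
    calc ‖θ‖ ^ 2 ≤ Real.sqrt d ^ 2 := by gcongr
      _ = (d : ℝ) := Real.sq_sqrt (by positivity)
  set u := ‖g‖ ^ 2 with hu
  have hu0 : 0 ≤ u := by positivity
  have hx : ‖Real.exp (-t) • θ + √s • g‖ ^ 2 ≤ 2 * (d + u) := by
    have h1 : ‖Real.exp (-t) • θ + √s • g‖ ≤ ‖θ‖ + ‖g‖ := by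
      refine (norm_add_le _ _).trans (add_le_add ?_ ?_)
      · rw [norm_smul, Real.norm_of_nonneg (Real.exp_pos _).le]
        exact mul_le_of_le_one_left (norm_nonneg _) he
      · rw [norm_smul, Real.norm_of_nonneg (Real.sqrt_nonneg _)]
        exact mul_le_of_le_one_left (norm_nonneg _) (Real.sqrt_le_one.2 hs1)
    calc _ ≤ (‖θ‖ + ‖g‖) ^ 2 := by gcongr
      _ ≤ 2 * (‖θ‖ ^ 2 + ‖g‖ ^ 2) := add_sq_le
      _ ≤ _ := by gcongr
  have hg4 : ‖√s • g‖ ^ 4 = s ^ 2 * u ^ 2 := by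
    rw [norm_smul, Real.norm_of_nonneg (Real.sqrt_nonneg _), mul_pow,
      show √s ^ 4 = (√s ^ 2) ^ 2 by ring, Real.sq_sqrt hs.le, hu]
    ring
  have hpoly : (d + u) * (1 + 2 * u ^ 2) ≤ 5 * ((d : ℝ) ^ 3 + u ^ 3) := by
    have h1 : (d : ℝ) ≤ (d : ℝ) ^ 3 := le_self_pow₀ hd1 (by norm_num)
    have h2 : u ≤ (d : ℝ) ^ 3 + u ^ 3 := by
      rcases le_total u 1 with h | h
      · have : 0 ≤ u ^ 3 := by positivity
        linarith
      · have := le_self_pow₀ h (by norm_num : 3 ≠ 0)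
        linarith
    have h3 : d * u ^ 2 ≤ (d : ℝ) ^ 3 + u ^ 3 := by
      rcases le_total u d with h | h
      · have : (d : ℝ) * u ^ 2 ≤ d * (d : ℝ) ^ 2 := by gcongr
        have : 0 ≤ u ^ 3 := by positivity
        linarith [pow_succ' (d : ℝ) 2]
      · have : d * u ^ 2 ≤ u * u ^ 2 := by gcongr
        have : 0 ≤ (d : ℝ) ^ 3 := by positivity
        linarith [pow_succ' u 2]
    have h4 : 0 ≤ u ^ 3 := by positivity
    nlinarith
  calc _ ≤ 3 * (2 * (d + u)) * (1 / s ^ 2 + 2 * (s ^ 2 * u ^ 2) / s ^ 4) := by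
        rw [hg4]
        gcongr
    _ = 6 / s ^ 2 * ((d + u) * (1 + 2 * u ^ 2)) := by field_simp; ring
    _ ≤ 6 / s ^ 2 * (5 * ((d : ℝ) ^ 3 + u ^ 3)) := by gcongr
    _ = _ := by rw [hu]; ring

lemma integral_le_of_lintegral_ofReal_le {α : Type*} [MeasurableSpace α] {μ : Measure α}
    {f : α → ℝ} {B : ℝ} (hB : 0 ≤ B) (hf : ∀ x, 0 ≤ f x)
    (h : ∫⁻ x, ENNReal.ofReal (f x) ∂μ ≤ ENNReal.ofReal B) : ∫ x, f x ∂μ ≤ B := by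
  by_cases hi : Integrable f μ
  · rw [integral_eq_lintegral_of_nonneg_ae (.of_forall hf) hi.aestronglyMeasurable]
    exact ENNReal.toReal_le_of_le_ofReal hB h
  · rwa [integral_undef hi]

/-- **Lemma (second moment of Hessian applied to the state).** Under the bounded-support
assumption, `E_{X ~ q_t}[‖∇_x² log q_t(X) · X‖²] ≤ C d³ σ_t⁻⁴` for a universal constant `C`. -/
theorem hessian_state_second_moment :
    ∃ C > (0:ℝ),
    ∀ (d : ℕ), 1 ≤ d →
    ∀ (q0 : Measure (Vec d)), IsProbabilityMeasure q0 →
    (∀ᵐ y ∂q0, ‖y‖ ≤ Real.sqrt d) →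
    ∀ (ρ : ℝ → Vec d → ℝ),
    (∀ u, 0 < u → forwardLaw q0 u = volume.withDensity fun x => ENNReal.ofReal (ρ u x)) →
    (∀ u, 0 < u → ∀ x, 0 < ρ u x) →
    (∀ u, 0 < u → ContDiff ℝ (⊤ : ℕ∞) (ρ u)) →
    ∀ (t : ℝ), 0 < t →
    ∫ x, ∑ i, (∑ j, pd i (pd j (fun y => Real.log (ρ t y))) x * x j)^2
        ∂(forwardLaw q0 t)
      ≤ C * (d:ℝ)^3 / (1 - Real.exp (-2*t))^2 := by
  have hM : 0 ≤ ∫ y, y ^ 6 ∂(gaussianReal 0 1) :=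
    integral_nonneg fun y => (by decide : Even 6).pow_nonneg y
  refine ⟨30 * (1 + ∫ y, y ^ 6 ∂(gaussianReal 0 1)), by positivity, ?_⟩
  intro d hd q0 _ hR ρ hlaw hpos hsmooth t ht
  have hs := one_sub_exp_neg_two_mul_pos ht
  have hc := gaussianNormalizer_pos d ht
  have hmix := density_eq_mixture q0 ht (hsmooth t ht).continuous (hpos t ht) (hlaw t ht)
  set K : Vec d → Vec d → ℝ := fun x θ => 3 * ‖x‖ ^ 2 * (1 / (1 - Real.exp (-2 * t)) ^ 2 +
    2 * ‖x - Real.exp (-t) • θ‖ ^ 4 / (1 - Real.exp (-2 * t)) ^ 4) with hK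
  have hK0 (x θ : Vec d) : 0 ≤ K x θ := by positivity
  have hKc : Continuous fun p : Vec d × Vec d => K p.1 p.2 := by fun_prop
  have hKx (x : Vec d) : Continuous (K x) := by fun_prop
  have hKθ (θ : Vec d) : Continuous fun x => K x θ := by fun_prop
  refine integral_le_of_lintegral_ofReal_le (by positivity)
    (fun x => Finset.sum_nonneg fun i _ => sq_nonneg _) ?_
  have hpoint (x : Vec d) : ENNReal.ofReal (ρ t x) *
      ENNReal.ofReal (∑ i, (∑ j, pd i (pd j (fun y => Real.log (ρ t y))) x * x j) ^ 2) ≤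
      ∫⁻ θ, ENNReal.ofReal (gaussianNormalizer d t * weight t x θ) * ENNReal.ofReal (K x θ)
        ∂q0 := by
    have hwx := continuous_weight_right t x
    have hb := integral_mul_sum_sq_le (μ := q0) (a := fun θ => x - Real.exp (-t) • θ)
      (fun θ => (weight_pos t x θ).le) (integral_weight_pos hR t x)
      (fun f hf => integrable_of_continuous_of_ae_norm_le hR (by fun_prop)) hs x
    simp_rw [← pd_pd_log_mixture hR ht (hsmooth t ht) (hpos t ht) hc hmix] at hb
    have hKint : Integrable (fun θ => gaussianNormalizer d t * (K x θ * weight t x θ)) q0 :=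
      integrable_of_continuous_of_ae_norm_le hR
        (continuous_const.mul ((hKx x).mul hwx))
    calc _ ≤ ENNReal.ofReal (gaussianNormalizer d t * ∫ θ, K x θ * weight t x θ ∂q0) := by
          rw [← ENNReal.ofReal_mul (hpos t ht x).le]
          refine ENNReal.ofReal_le_ofReal ?_
          rw [hmix x, mul_assoc]
          exact mul_le_mul_of_nonneg_left hb hc.le
      _ = ∫⁻ θ, ENNReal.ofReal (gaussianNormalizer d t * (K x θ * weight t x θ)) ∂q0 := by
          rw [← integral_const_mul, ofReal_integral_eq_lintegral_ofReal hKint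
            (.of_forall fun θ => mul_nonneg hc.le (mul_nonneg (hK0 x θ) (weight_pos t x θ).le))]
      _ = _ := by
          refine lintegral_congr fun θ => ?_
          rw [← ENNReal.ofReal_mul (mul_nonneg hc.le (weight_pos t x θ).le)]
          congr 1
          ring
  have hw := continuous_weight (d := d) t
  rw [hlaw t ht, lintegral_withDensity_eq_lintegral_mul_non_measurable _
    (hsmooth t ht).continuous.measurable.ennreal_ofReal (.of_forall fun x => ENNReal.ofReal_lt_top)]
  calc _ ≤ ∫⁻ x, ∫⁻ θ, ENNReal.ofReal (gaussianNormalizer d t * weight t x θ) *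
          ENNReal.ofReal (K x θ) ∂q0 := lintegral_mono hpoint
    _ = ∫⁻ θ, ∫⁻ x, ENNReal.ofReal (gaussianNormalizer d t * weight t x θ) *
          ENNReal.ofReal (K x θ) ∂volume ∂q0 := by
        refine lintegral_lintegral_swap (Measurable.aemeasurable ?_)
        exact (hw.measurable.const_mul _).ennreal_ofReal.mul hKc.measurable.ennreal_ofReal
    _ = ∫⁻ θ, ∫⁻ g, ENNReal.ofReal
          (K (Real.exp (-t) • θ + Real.sqrt (1 - Real.exp (-2 * t)) • g) θ)
          ∂(_root_.stdGaussian d) ∂q0 :=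
        lintegral_congr fun θ =>
          (lintegral_stdGaussian_comp ht θ (hKθ θ).measurable.ennreal_ofReal).symm
    _ ≤ ∫⁻ _, ENNReal.ofReal (30 / (1 - Real.exp (-2 * t)) ^ 2 *
          ((1 + ∫ y, y ^ 6 ∂(gaussianReal 0 1)) * (d : ℝ) ^ 3)) ∂q0 := by
        refine lintegral_mono_ae ?_
        filter_upwards [hR] with θ hθ
        refine le_trans (lintegral_mono fun g => ENNReal.ofReal_le_ofReal ?_)
          (lintegral_stdGaussian_le (by positivity))
        simpa only [hK, add_sub_cancel_left] using three_mul_norm_sq_mul_le hd ht hθ g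
    _ = _ := by
        rw [lintegral_const, measure_univ, mul_one]
        congr 1
        ring

end
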